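/- Suppose all the tau functions are nonzero and satisfy all the bilinear equations ⟨J,i⟩ (1 ≤ J ≤ 4, 0 ≤ i ≤ n). Set x = [λ; τ3, W, τ2] and y = [κ; τ2, N, τ1], and let γ = (k−l)·β/(l·k·α). Then the functions V_i and U_i evaluated at (x,y) are given by: V_0 = V_0^{σ✶} = γ·τ2_0·τ4_0/(τ1_0·τ3_0); V_0^{σ_1} = γ·τ2_1·τ4_1/(τ1_1·τ3_1); U_1 = γ²·τ2_0·τ2_1·τ4_0·τ4_1/(τ1_0·τ1_1·τ3_0·τ3_1); V_1 = V_1^{σ_1} = γ·S_1·τ2_0·τ2_1/(N_1·τ3_0·τ3_1); V_1^{σ✶} = γ·E_1·τ2_0·τ2_1/(W_1·τ1_0·τ1_1); for 2 ≤ i ≤ n−2: V_i = V_i^{σ_1} = γ·S_i·τ2_i/(N_i·τ3_i), V_i^{σ✶} = γ·E_i·τ2_i/(W_i·τ1_i), U_i = γ²·τ2_i·τ4_i/(τ1_i·τ3_i); V_{n−1} = V_{n−1}^{σ_1} = γ·τ2_n·τ4_n/(τ1_n·τ3_n); V_{n−1}^{σ✶} = V_{n−1}^{σ_n} = γ·τ2_{n−1}·τ4_{n−1}/(τ1_{n−1}·τ3_{n−1});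 U_{n−1} = γ²·τ2_{n−1}·τ2_n·τ4_{n−1}·τ4_n/(τ1_{n−1}·τ1_n·τ3_{n−1}·τ3_n). -/

import Mathlib

/-- The `D^(1)_n` bilinear equation `⟨J,i⟩` on the tau functions. -/
def BE {F : Type*} [Field F] (n : ℕ)
    (lam lamb kap kapb S W N E t0 t1 t2 t3 t4 : ℕ → F)
    (α β : F) (J i : ℕ) : Prop :=
  if J = 1 then
    if i = 0 then kapb 1 * N 1 * t4 1 - lamb 1 * E 1 * t2 1 = α * t0 0 * t1 0
    else if i = 1 then kap 1 * N 1 * t4 0 - lam 1 * E 1 * t2 0 = α * t0 1 * t1 1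
    else if i = n - 1 then
      kap (n - 1) * kap n * E (n - 2) * t2 n - lam (n - 1) * lam n * N (n - 2) * t4 n
        = α * t0 (n - 1) * t1 n
    else if i = n then
      kap (n - 1) * E (n - 2) * t2 (n - 1) - lam (n - 1) * N (n - 2) * t4 (n - 1)
        = α * t0 n * t1 (n - 1)
    else kap i * E (i - 1) * N i - lam i * N (i - 1) * E i = α * t0 i * t1 i
  else if J = 2 then
    if i = 0 then kap 1 * N 1 * t3 1 + lamb 1 * W 1 * t1 1 = β * t0 0 * t2 0
    else if i = 1 then kapb 1 * N 1 * t3 0 + lam 1 * W 1 * t1 0 = β * t0 1 * t2 1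
    else if i = n - 1 then
      kap n * kapb (n - 1) * W (n - 2) * t1 (n - 1) + lam (n - 1) * N (n - 2) * t3 (n - 1)
        = β * t0 (n - 1) * t2 (n - 1)
    else if i = n then
      kapb (n - 1) * W (n - 2) * t1 n + lam (n - 1) * lam n * N (n - 2) * t3 n
        = β * t0 n * t2 n
    else kapb i * W (i - 1) * N i + lam i * N (i - 1) * W i = β * t0 i * t2 i
  else if J = 3 then
    if i = 0 then kap 1 * S 1 * t2 1 - lam 1 * W 1 * t4 1 = α * t0 0 * t3 0
    else if i = 1 then kapb 1 * S 1 * t2 0 - lamb 1 * W 1 * t4 0 = α * t0 1 * t3 1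
    else if i = n - 1 then
      kapb (n - 1) * W (n - 2) * t4 n - lamb (n - 1) * S (n - 2) * t2 n
        = α * t0 (n - 1) * t3 n
    else if i = n then
      kap n * kapb (n - 1) * W (n - 2) * t4 (n - 1) - lam n * lamb (n - 1) * S (n - 2) * t2 (n - 1)
        = α * t0 n * t3 (n - 1)
    else kapb i * W (i - 1) * S i - lamb i * S (i - 1) * W i = α * t0 i * t3 i
  else if J = 4 then
    if i = 0 then kapb 1 * S 1 * t1 1 + lam 1 * E 1 * t3 1 = β * t0 0 * t4 0
    else if i = 1 then kap 1 * S 1 * t1 0 + lamb 1 * E 1 * t3 0 = β * t0 1 * t4 1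
    else if i = n - 1 then
      kap (n - 1) * E (n - 2) * t3 (n - 1) + lam n * lamb (n - 1) * S (n - 2) * t1 (n - 1)
        = β * t0 (n - 1) * t4 (n - 1)
    else if i = n then
      kap (n - 1) * kap n * E (n - 2) * t3 n + lamb (n - 1) * S (n - 2) * t1 n
        = β * t0 n * t4 n
    else kap i * E (i - 1) * S i + lamb i * S (i - 1) * E i = β * t0 i * t4 i
  else True

/-- The level `ℓ(x)` of an element of `B`, represented by the pair of families
`x = (x_1,…,x_n)` and `xb = (x̄_1,…,x̄_{n-1})`. -/
def lev {F : Type*} [Field F] (n : ℕ) (x xb : ℕ → F) : F :=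
  (∏ i ∈ Finset.Icc 1 n, x i) * ∏ i ∈ Finset.Icc 1 (n - 1), xb i

/-- The functions `V_0, V_1, …, V_{n-1}` of the `D^(1)_n` tropical `R`. -/
def Vf {F : Type*} [Field F] (n : ℕ) (x xb y yb : ℕ → F) : ℕ → F
  | 0 =>
      lev n x xb * (y 1 / yb 1)
      + lev n x xb *
          ∑ m ∈ Finset.Icc 2 (n - 1), (∏ i ∈ Finset.Icc 1 (m - 1), y i / x i) * (1 + y m / yb m)
      + x n * y n * ∏ i ∈ Finset.Icc 1 (n - 1), xb i * y i
      + lev n y yb * (xb 1 / x 1)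
      + lev n y yb *
          ∑ m ∈ Finset.Icc 2 (n - 1), (∏ i ∈ Finset.Icc 1 (m - 1), xb i / yb i) * (1 + xb m / x m)
      + ∏ i ∈ Finset.Icc 1 (n - 1), xb i * y i
  | (i + 1) =>
      if i + 1 = n - 1 then
        (yb (i + 1) / y n) * (y n * Vf n x xb y yb i / xb (i + 1)
          + (lev n x xb - lev n y yb) * (y n / x (i + 1) + 1 / yb (i + 1)))
      else
        yb (i + 1) * (Vf n x xb y yb i / xb (i + 1)
          + (lev n x xb - lev n y yb) * (1 / x (i + 1) + 1 / yb (i + 1)))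

/-- `σ_1` (first component): swap the indices `1` of the two families. -/
def sw1 {F : Type*} (x xb : ℕ → F) : ℕ → F := fun i => if i = 1 then xb 1 else x i

/-- `σ_n` on the unbarred family. -/
def snx {F : Type*} [Field F] (n : ℕ) (x : ℕ → F) : ℕ → F :=
  fun i => if i = n - 1 then x (n - 1) * x n else if i = n then (x n)⁻¹ else x i

/-- `σ_n` on the barred family. -/
def snxb {F : Type*} [Field F] (n : ℕ) (x xb : ℕ → F) : ℕ → F :=
  fun i => if i = n - 1 then xb (n - 1) * x n else xb i

/-- `σ✶` (unbarred part of the first component of `σ✶(x,y)`, built from `y`). -/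
def stx {F : Type*} (n : ℕ) (y yb : ℕ → F) : ℕ → F := fun i => if i = n then y n else yb i

/-- `V_i^{σ_1}`. -/
def Vs1 {F : Type*} [Field F] (n : ℕ) (x xb y yb : ℕ → F) : ℕ → F :=
  Vf n (sw1 x xb) (sw1 xb x) (sw1 y yb) (sw1 yb y)

/-- `V_i^{σ_n}`. -/
def Vsn {F : Type*} [Field F] (n : ℕ) (x xb y yb : ℕ → F) : ℕ → F :=
  Vf n (snx n x) (snxb n x xb) (snx n y) (snxb n y yb)

/-- `V_i^{σ✶}`. -/
def Vst {F : Type*} [Field F] (n : ℕ) (x xb y yb : ℕ → F) : ℕ → F :=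
  Vf n (stx n y yb) y (stx n x xb) x

/-- The functions `U_1, …, U_{n-1}` of the `D^(1)_n` tropical `R`. -/
def Uf {F : Type*} [Field F] (n : ℕ) (x xb y yb : ℕ → F) : ℕ → F := fun i =>
  if i = 1 then Vf n x xb y yb 0 * Vs1 n x xb y yb 0
  else if i = n - 1 then Vf n x xb y yb (n - 1) * Vst n x xb y yb (n - 1)
  else (1 / x i + 1 / yb i)⁻¹ *
    (Vf n x xb y yb i * Vst n x xb y yb (i - 1) / y i
      + Vf n x xb y yb (i - 1) * Vst n x xb y yb i / xb i)

/-- unbarred part `x'` of the output of the tropical `R`. -/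
def Rx {F : Type*} [Field F] (n : ℕ) (x xb y yb : ℕ → F) : ℕ → F := fun i =>
  if i = 1 then y 1 * Vs1 n x xb y yb 0 / Vf n x xb y yb 1
  else if i = n then y n * Vf n x xb y yb (n - 1) / Vsn n x xb y yb (n - 1)
  else y i * Vf n x xb y yb (i - 1) * Uf n x xb y yb i
        / (Vf n x xb y yb i * Uf n x xb y yb (i - 1))

/-- barred part `x̄'` of the output of the tropical `R`. -/
def Rxb {F : Type*} [Field F] (n : ℕ) (x xb y yb : ℕ → F) : ℕ → F := fun i =>
  if i = 1 then yb 1 * Vf n x xb y yb 0 / Vf n x xb y yb 1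
  else yb i * Vf n x xb y yb (i - 1) / Vf n x xb y yb i

/-- unbarred part `y'` of the output of the tropical `R`. -/
def Ry {F : Type*} [Field F] (n : ℕ) (x xb y yb : ℕ → F) : ℕ → F := fun i =>
  if i = 1 then x 1 * Vf n x xb y yb 0 / Vst n x xb y yb 1
  else if i = n then x n * Vsn n x xb y yb (n - 1) / Vf n x xb y yb (n - 1)
  else x i * Vst n x xb y yb (i - 1) / Vst n x xb y yb i

/-- barred part `ȳ'` of the output of the tropical `R`. -/
def Ryb {F : Type*} [Field F] (n : ℕ) (x xb y yb : ℕ → F) : ℕ → F := fun i =>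
  if i = 1 then xb 1 * Vs1 n x xb y yb 0 / Vst n x xb y yb 1
  else xb i * Vst n x xb y yb (i - 1) * Uf n x xb y yb i
        / (Vst n x xb y yb i * Uf n x xb y yb (i - 1))

/-- Admissibility: all the quantities `V_i`, `U_i` and their `σ`-transforms appearing in
the formulas of the tropical `R` are nonzero. -/
def Adm {F : Type*} [Field F] (n : ℕ) (x xb y yb : ℕ → F) : Prop :=
  (∀ i ≤ n - 1, Vf n x xb y yb i ≠ 0) ∧
  (∀ i ≤ n - 1, Vst n x xb y yb i ≠ 0) ∧
  Vs1 n x xb y yb 0 ≠ 0 ∧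
  Vsn n x xb y yb (n - 1) ≠ 0 ∧
  (∀ i, 1 ≤ i → i ≤ n - 1 → Uf n x xb y yb i ≠ 0)

/-- The unbarred part of `[μ; τ, C, τ']`. -/
def brkX {F : Type*} [Field F] (n : ℕ) (μ τ C τ' : ℕ → F) : ℕ → F := fun i =>
  if i = 1 then (μ 1)⁻¹ * (τ 0 * τ' 1 / C 1)
  else if i = 2 then (μ 2)⁻¹ * (C 1 * τ' 2 / (C 2 * τ' 0 * τ' 1))
  else if i = n - 1 then (μ (n - 1))⁻¹ * (C (n - 2) * τ' (n - 1) / (τ (n - 1) * τ' (n - 2)))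
  else if i = n then (μ n)⁻¹ * (τ (n - 1) * τ' n / (τ n * τ' (n - 1)))
  else (μ i)⁻¹ * (C (i - 1) * τ' i / (C i * τ' (i - 1)))

/-- The barred part of `[μ; τ, C, τ']` (here `μb` is the barred part of `μ`). -/
def brkXb {F : Type*} [Field F] (n : ℕ) (μb τ C τ' : ℕ → F) : ℕ → F := fun i =>
  if i = 1 then (μb 1)⁻¹ * (τ 1 * τ' 0 / C 1)
  else if i = 2 then (μb 2)⁻¹ * (C 1 * τ 2 / (C 2 * τ 0 * τ 1))
  else if i = n - 1 then (μb (n - 1))⁻¹ * (C (n - 2) * τ n / (τ (n - 2) * τ' n))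
  else (μb i)⁻¹ * (C (i - 1) * τ i / (C i * τ (i - 1)))

/-- Data `(v, w)` solving the recursions for `V_i` and `V_i^{σ✶}` in the range `1 ≤ i ≤ n-2`,
together with the relation at the last node that fixes the common initial value. -/
structure VRec {F : Type*} [Field F] (n : ℕ) (x xb y yb v w : ℕ → F) : Prop where
  x_ne : ∀ i, 1 ≤ i → i ≤ n → x i ≠ 0
  xb_ne : ∀ i, 1 ≤ i → i ≤ n - 1 → xb i ≠ 0
  y_ne : ∀ i, 1 ≤ i → i ≤ n → y i ≠ 0
  yb_ne : ∀ i, 1 ≤ i → i ≤ n - 1 → yb i ≠ 0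
  lev_ne : lev n x xb - lev n y yb ≠ 0
  zero_eq : v 0 = w 0
  v_succ : ∀ i, i + 1 ≤ n - 2 → v (i + 1) = yb (i + 1) * (v i / xb (i + 1)
    + (lev n x xb - lev n y yb) * (1 / x (i + 1) + 1 / yb (i + 1)))
  w_succ : ∀ i, i + 1 ≤ n - 2 → w (i + 1) = x (i + 1) * (w i / y (i + 1)
    + (lev n y yb - lev n x xb) * (1 / yb (i + 1) + 1 / x (i + 1)))
  closing : y n * yb (n - 1) / xb (n - 1) * v (n - 2) - x n * x (n - 1) / y (n - 1) * w (n - 2)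
    + (lev n x xb - lev n y yb) * (x n * x (n - 1) / yb (n - 1) + y n * yb (n - 1) / x (n - 1)
      + x n * y n + 1) = 0

theorem sum_prod_telescope {F : Type*} [Field F] (x y yb w : ℕ → F) (δ : F) (N : ℕ)
    (hx : ∀ i, 1 ≤ i → i ≤ N + 1 → x i ≠ 0) (hy : ∀ i, 1 ≤ i → i ≤ N + 1 → y i ≠ 0)
    (hyb : ∀ i, 1 ≤ i → i ≤ N + 1 → yb i ≠ 0)
    (hw : ∀ i, i + 1 ≤ N → w (i + 1) = x (i + 1) * (w i / y (i + 1)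
      - δ * (1 / yb (i + 1) + 1 / x (i + 1)))) :
    δ * (y 1 / yb 1 + ∑ m ∈ Finset.Icc 2 (N + 1),
        (∏ i ∈ Finset.Icc 1 (m - 1), y i / x i) * (1 + y m / yb m))
      = w 0 - (∏ i ∈ Finset.Icc 1 N, y i / x i) * w N
        + δ * (∏ i ∈ Finset.Icc 1 (N + 1), y i / x i) * (x (N + 1) / yb (N + 1)) := by
  induction N with
  | zero =>
    have h1 := hx 1 le_rfl le_rfl
    have h2 := hyb 1 le_rfl le_rfl
    simp
    field_simp
  | succ N ih =>
    have ih := ih (fun i h h' => hx i h (by omega)) (fun i h h' => hy i h (by omega))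
      (fun i h h' => hyb i h (by omega)) (fun i h => hw i (by omega))
    rw [Finset.sum_Icc_succ_top (by omega), ← add_assoc, mul_add, ih, hw N le_rfl]
    simp only [Finset.prod_Icc_succ_top (show 1 ≤ N + 1 + 1 by omega),
      Finset.prod_Icc_succ_top (show 1 ≤ N + 1 by omega), Nat.add_sub_cancel]
    generalize (∏ i ∈ Finset.Icc 1 N, y i / x i) = P
    have h1 := hx (N + 1) (by omega) (by omega)
    have h2 := hx (N + 1 + 1) (by omega) (by omega)
    have h3 := hy (N + 1) (by omega) (by omega)
    have h4 := hyb (N + 1) (by omega) (by omega)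
    have h5 := hyb (N + 1 + 1) (by omega) (by omega)
    field_simp
    ring

theorem lev_mul_prod_div {F : Type*} [Field F] (n : ℕ) (hn : 1 ≤ n) (x xb y : ℕ → F)
    (hx : ∀ i, 1 ≤ i → i ≤ n → x i ≠ 0) :
    lev n x xb * ∏ i ∈ Finset.Icc 1 (n - 1), y i / x i
      = x n * ∏ i ∈ Finset.Icc 1 (n - 1), xb i * y i := by
  obtain ⟨p, rfl⟩ : ∃ p, n = p + 1 := ⟨n - 1, by omega⟩
  rw [lev, Finset.prod_Icc_succ_top (by omega), Finset.prod_div_distrib,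
    Finset.prod_mul_distrib, Nat.add_sub_cancel]
  have : ∏ i ∈ Finset.Icc 1 p, x i ≠ 0 := Finset.prod_ne_zero_iff.2 fun i hi => by
    rw [Finset.mem_Icc] at hi
    exact hx i hi.1 (by omega)
  field_simp

theorem lev_stx {F : Type*} [Field F] (n : ℕ) (hn : 1 ≤ n) (y yb : ℕ → F) :
    lev n (stx n y yb) y = lev n y yb := by
  obtain ⟨p, rfl⟩ : ∃ p, n = p + 1 := ⟨n - 1, by omega⟩
  simp only [lev, Finset.prod_Icc_succ_top (show 1 ≤ p + 1 by omega), Nat.add_sub_cancel]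
  have : ∏ i ∈ Finset.Icc 1 p, stx (p + 1) y yb i = ∏ i ∈ Finset.Icc 1 p, yb i :=
    Finset.prod_congr rfl fun i hi => by
      rw [Finset.mem_Icc] at hi
      simp [stx, show i ≠ p + 1 by omega]
  rw [this]
  simp [stx]
  ring

theorem lev_sw1 {F : Type*} [Field F] (n : ℕ) (hn : 2 ≤ n) (x xb : ℕ → F) :
    lev n (sw1 x xb) (sw1 xb x) = lev n x xb := by
  obtain ⟨p, rfl⟩ : ∃ p, n = p + 2 := ⟨n - 2, by omega⟩
  have prod_sw1 : ∀ (a b : ℕ → F) (p : ℕ), ∏ i ∈ Finset.Icc 1 (p + 1), sw1 a b i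
      = b 1 * ∏ i ∈ Finset.Icc 2 (p + 1), a i := by
    intro a b p
    induction p with
    | zero => simp [sw1]
    | succ p ih =>
      rw [Finset.prod_Icc_succ_top (show 1 ≤ p + 1 + 1 by omega), ih,
        Finset.prod_Icc_succ_top (show 2 ≤ p + 1 + 1 by omega)]
      simp [sw1, mul_assoc]
  have prod_split : ∀ (a : ℕ → F) (p : ℕ), ∏ i ∈ Finset.Icc 1 (p + 1), a i
      = a 1 * ∏ i ∈ Finset.Icc 2 (p + 1), a i := by
    intro a p
    rw [← prod_sw1 a a p]
    exact Finset.prod_congr rfl fun i _ => by by_cases h : i = 1 <;> simp [sw1, h]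
  simp only [lev, show p + 2 - 1 = p + 1 from rfl, show p + 2 = (p + 1) + 1 from rfl,
    prod_sw1, prod_split]
  ring

theorem lev_snx {F : Type*} [Field F] (n : ℕ) (hn : 2 ≤ n) (x xb : ℕ → F) (hx : x n ≠ 0) :
    lev n (snx n x) (snxb n x xb) = lev n x xb := by
  obtain ⟨p, rfl⟩ : ∃ p, n = p + 2 := ⟨n - 2, by omega⟩
  simp only [lev, show p + 2 - 1 = p + 1 from rfl,
    Finset.prod_Icc_succ_top (show 1 ≤ p + 1 by omega),
    Finset.prod_Icc_succ_top (show 1 ≤ p + 2 by omega)]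
  have h₁ : ∏ i ∈ Finset.Icc 1 p, snx (p + 2) x i = ∏ i ∈ Finset.Icc 1 p, x i :=
    Finset.prod_congr rfl fun i hi => by
      rw [Finset.mem_Icc] at hi
      simp [snx, show i ≠ p + 1 by omega, show i ≠ p + 2 by omega]
  have h₂ : ∏ i ∈ Finset.Icc 1 p, snxb (p + 2) x xb i = ∏ i ∈ Finset.Icc 1 p, xb i :=
    Finset.prod_congr rfl fun i hi => by
      rw [Finset.mem_Icc] at hi
      simp [snxb, show i ≠ p + 1 by omega]
  rw [h₁, h₂]
  simp [snx, snxb]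
  field_simp

namespace VRec

variable {F : Type*} [Field F] {n : ℕ} {x xb y yb v w : ℕ → F}

theorem Vf_zero (hn : 2 ≤ n) (h : VRec n x xb y yb v w) : Vf n x xb y yb 0 = v 0 := by
  have hP := lev_mul_prod_div n (by omega) x xb y h.x_ne
  have hQ : lev n y yb * ∏ i ∈ Finset.Icc 1 (n - 1), xb i / yb i
      = y n * ∏ i ∈ Finset.Icc 1 (n - 1), xb i * y i := by
    have := lev_mul_prod_div n (by omega) (stx n y yb) y xb fun i h1 h2 => by
      by_cases hi : i = n
      · simpa [stx, hi] using h.y_ne n (by omega) le_rfl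
      · simpa [stx, hi] using h.yb_ne i h1 (by omega)
    rw [lev_stx n (by omega)] at this
    convert this using 2
    · exact Finset.prod_congr rfl fun i hi => by
        rw [Finset.mem_Icc] at hi
        simp [stx, show i ≠ n by omega]
    · simp [stx]
    · exact Finset.prod_congr rfl fun i _ => mul_comm _ _
  obtain ⟨p, rfl⟩ : ∃ p, n = p + 2 := ⟨n - 2, by omega⟩
  have T₁ := sum_prod_telescope x y yb w (lev (p + 2) x xb - lev (p + 2) y yb) p
    (fun i h1 h2 => h.x_ne i h1 (by omega)) (fun i h1 h2 => h.y_ne i h1 (by omega))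
    (fun i h1 h2 => h.yb_ne i h1 (by omega))
    (fun i hi => by rw [h.w_succ i (by omega)]; ring)
  have T₂ := sum_prod_telescope yb xb x v (lev (p + 2) y yb - lev (p + 2) x xb) p
    (fun i h1 h2 => h.yb_ne i h1 (by omega)) (fun i h1 h2 => h.xb_ne i h1 (by omega))
    (fun i h1 h2 => h.x_ne i h1 (by omega))
    (fun i hi => by rw [h.v_succ i (by omega)]; ring)
  have hδ := h.lev_ne
  have hc := h.closing
  have hi := h.zero_eq
  simp only [Vf, show p + 2 - 1 = p + 1 from rfl, show p + 2 - 2 = p from rfl] at *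
  rw [Finset.prod_Icc_succ_top (by omega)] at T₁ T₂
  rw [Finset.prod_Icc_succ_top (show 1 ≤ p + 1 by omega) (fun i => y i / x i)] at hP
  rw [Finset.prod_Icc_succ_top (show 1 ≤ p + 1 by omega) (fun i => xb i / yb i)] at hQ
  have h1 := h.x_ne (p + 1) (by omega) (by omega)
  have h2 := h.xb_ne (p + 1) (by omega) (by simp)
  have h3 := h.y_ne (p + 1) (by omega) (by omega)
  have h4 := h.yb_ne (p + 1) (by omega) (by simp)
  generalize (∏ i ∈ Finset.Icc 1 p, y i / x i) = P at *
  generalize (∏ i ∈ Finset.Icc 1 p, xb i / yb i) = Q at *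
  generalize (∏ i ∈ Finset.Icc 1 (p + 1), xb i * y i) = M at *
  generalize (∑ m ∈ Finset.Icc 2 (p + 1),
    (∏ i ∈ Finset.Icc 1 (m - 1), y i / x i) * (1 + y m / yb m)) = A at *
  generalize (∑ m ∈ Finset.Icc 2 (p + 1),
    (∏ i ∈ Finset.Icc 1 (m - 1), xb i / yb i) * (1 + xb m / x m)) = B at *
  generalize lev (p + 2) x xb = L at *
  generalize lev (p + 2) y yb = K at *
  have hP' : L * P = x (p + 2) * M * (x (p + 1) / y (p + 1)) := by
    rw [← hP]; field_simp
  have hQ' : K * Q = y (p + 2) * M * (yb (p + 1) / xb (p + 1)) := by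
    rw [← hQ]; field_simp
  refine mul_left_cancel₀ hδ ?_
  linear_combination L * T₁ - K * T₂ + (L - K) * (x (p + 1) / yb (p + 1)) * hP
    + (L - K) * (yb (p + 1) / x (p + 1)) * hQ - w p * hP' + v p * hQ' + M * hc - L * hi

theorem Vf_eq (hn : 2 ≤ n) (h : VRec n x xb y yb v w) (i : ℕ) (hi : i ≤ n - 2) :
    Vf n x xb y yb i = v i := by
  induction i with
  | zero => exact h.Vf_zero hn
  | succ i ih => rw [Vf, if_neg (by omega), ih (by omega), h.v_succ i hi]

theorem star (hn : 2 ≤ n) (h : VRec n x xb y yb v w) :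
    VRec n (stx n y yb) y (stx n x xb) x w v where
  x_ne i h1 h2 := by
    by_cases hi : i = n
    · simpa [stx, hi] using h.y_ne n (by omega) le_rfl
    · simpa [stx, hi] using h.yb_ne i h1 (by omega)
  xb_ne i h1 h2 := h.y_ne i h1 (by omega)
  y_ne i h1 h2 := by
    by_cases hi : i = n
    · simpa [stx, hi] using h.x_ne n (by omega) le_rfl
    · simpa [stx, hi] using h.xb_ne i h1 (by omega)
  yb_ne i h1 h2 := h.x_ne i h1 (by omega)
  lev_ne := by
    rw [lev_stx n (by omega), lev_stx n (by omega), ← neg_sub]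
    exact neg_ne_zero.2 h.lev_ne
  zero_eq := h.zero_eq.symm
  v_succ i hi := by
    rw [lev_stx n (by omega), lev_stx n (by omega), h.w_succ i hi]
    simp [stx, show i + 1 ≠ n by omega]
  w_succ i hi := by
    rw [lev_stx n (by omega), lev_stx n (by omega), h.v_succ i hi]
    simp [stx, show i + 1 ≠ n by omega]
  closing := by
    rw [lev_stx n (by omega), lev_stx n (by omega)]
    simp only [stx, show n - 1 ≠ n by omega, if_true, if_false]
    linear_combination - h.closing

theorem Vst_eq (hn : 2 ≤ n) (h : VRec n x xb y yb v w) (i : ℕ) (hi : i ≤ n - 2) :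
    Vst n x xb y yb i = w i :=
  (h.star hn).Vf_eq hn i hi

theorem swap_one (hn : 4 ≤ n) (h : VRec n x xb y yb v w) (c : F)
    (hv : v 1 = y 1 * (c / x 1 + (lev n x xb - lev n y yb) * (1 / xb 1 + 1 / y 1)))
    (hw : w 1 = xb 1 * (c / yb 1 + (lev n y yb - lev n x xb) * (1 / y 1 + 1 / xb 1))) :
    VRec n (sw1 x xb) (sw1 xb x) (sw1 y yb) (sw1 yb y)
      (Function.update v 0 c) (Function.update w 0 c) where
  x_ne i h1 h2 := by
    by_cases hi : i = 1
    · simpa [sw1, hi] using h.xb_ne 1 le_rfl (by omega)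
    · simpa [sw1, hi] using h.x_ne i h1 h2
  xb_ne i h1 h2 := by
    by_cases hi : i = 1
    · simpa [sw1, hi] using h.x_ne 1 le_rfl (by omega)
    · simpa [sw1, hi] using h.xb_ne i h1 h2
  y_ne i h1 h2 := by
    by_cases hi : i = 1
    · simpa [sw1, hi] using h.yb_ne 1 le_rfl (by omega)
    · simpa [sw1, hi] using h.y_ne i h1 h2
  yb_ne i h1 h2 := by
    by_cases hi : i = 1
    · simpa [sw1, hi] using h.y_ne 1 le_rfl (by omega)
    · simpa [sw1, hi] using h.yb_ne i h1 h2
  lev_ne := by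
    rw [lev_sw1 n (by omega), lev_sw1 n (by omega)]
    exact h.lev_ne
  zero_eq := by simp
  v_succ i hi := by
    rw [lev_sw1 n (by omega), lev_sw1 n (by omega)]
    rcases Nat.eq_zero_or_pos i with rfl | hi'
    · simpa [sw1] using hv
    · simpa [sw1, hi'.ne'] using h.v_succ i hi
  w_succ i hi := by
    rw [lev_sw1 n (by omega), lev_sw1 n (by omega)]
    rcases Nat.eq_zero_or_pos i with rfl | hi'
    · simpa [sw1] using hw
    · simpa [sw1, hi'.ne'] using h.w_succ i hi
  closing := by
    rw [lev_sw1 n (by omega), lev_sw1 n (by omega)]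
    simpa only [sw1, show n - 1 ≠ 1 by omega, show n ≠ 1 by omega, if_false, ne_eq,
      show n - 2 ≠ 0 by omega, not_false_eq_true, Function.update_of_ne] using h.closing

theorem sigma_last (hn : 2 ≤ n) (h : VRec n x xb y yb v w) :
    VRec n (snx n x) (snxb n x xb) (snx n y) (snxb n y yb) v w := by
  have hxn := h.x_ne n (by omega) le_rfl
  have hyn := h.y_ne n (by omega) le_rfl
  have hx := h.x_ne (n - 1)
  have hxb := h.xb_ne (n - 1)
  have hy := h.y_ne (n - 1)
  have hyb := h.yb_ne (n - 1)
  have hne : n ≠ n - 1 := by omega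
  constructor
  · intro i h1 h2
    have := h.x_ne i h1 h2
    unfold snx
    split_ifs with hi <;> [subst hi; skip; skip] <;> simp_all
  · intro i h1 h2
    have := h.xb_ne i h1 h2
    unfold snxb
    split_ifs with hi <;> [subst hi; skip] <;> simp_all
  · intro i h1 h2
    have := h.y_ne i h1 h2
    unfold snx
    split_ifs with hi <;> [subst hi; skip; skip] <;> simp_all
  · intro i h1 h2
    have := h.yb_ne i h1 h2
    unfold snxb
    split_ifs with hi <;> [subst hi; skip] <;> simp_all
  · rw [lev_snx n hn _ _ hxn, lev_snx n hn _ _ hyn]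
    exact h.lev_ne
  · exact h.zero_eq
  · intro i hi
    rw [lev_snx n hn _ _ hxn, lev_snx n hn _ _ hyn]
    simpa only [snx, snxb, show i + 1 ≠ n - 1 by omega, show i + 1 ≠ n by omega, if_false]
      using h.v_succ i hi
  · intro i hi
    rw [lev_snx n hn _ _ hxn, lev_snx n hn _ _ hyn]
    simpa only [snx, snxb, show i + 1 ≠ n - 1 by omega, show i + 1 ≠ n by omega, if_false]
      using h.w_succ i hi
  · rw [lev_snx n hn _ _ hxn, lev_snx n hn _ _ hyn]
    have hc := h.closing
    replace hx := hx (by omega) (by omega)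
    replace hxb := hxb (by omega) (by omega)
    replace hy := hy (by omega) (by omega)
    replace hyb := hyb (by omega) (by omega)
    simp only [snx, snxb, hne, if_true, if_false]
    refine mul_left_cancel₀ (mul_ne_zero hxn hyn) ?_
    rw [mul_zero, ← hc]
    field_simp
    ring

theorem Vf_last (hn : 2 ≤ n) (h : VRec n x xb y yb v w) :
    Vf n x xb y yb (n - 1) = yb (n - 1) / y n * (y n * v (n - 2) / xb (n - 1)
      + (lev n x xb - lev n y yb) * (y n / x (n - 1) + 1 / yb (n - 1))) := by
  rw [← h.Vf_eq hn (n - 2) le_rfl]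
  obtain ⟨p, rfl⟩ : ∃ p, n = p + 2 := ⟨n - 2, by omega⟩
  simp [Vf]

theorem Vst_last (hn : 2 ≤ n) (h : VRec n x xb y yb v w) :
    Vst n x xb y yb (n - 1) = x (n - 1) / x n * (x n * w (n - 2) / y (n - 1)
      + (lev n y yb - lev n x xb) * (x n / yb (n - 1) + 1 / x (n - 1))) := by
  rw [Vst, (h.star hn).Vf_last hn, lev_stx n (by omega), lev_stx n (by omega)]
  simp [stx, show n - 1 ≠ n by omega]

theorem Vsn_last (hn : 2 ≤ n) (h : VRec n x xb y yb v w) :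
    Vsn n x xb y yb (n - 1) = Vst n x xb y yb (n - 1) := by
  have hxn := h.x_ne n (by omega) le_rfl
  have hyn := h.y_ne n (by omega) le_rfl
  have hx := h.x_ne (n - 1) (by omega) (by omega)
  have hxb := h.xb_ne (n - 1) (by omega) (by omega)
  have hy := h.y_ne (n - 1) (by omega) (by omega)
  have hyb := h.yb_ne (n - 1) (by omega) (by omega)
  rw [Vsn, (h.sigma_last hn).Vf_last hn, h.Vst_last hn, lev_snx n hn _ _ hxn,
    lev_snx n hn _ _ hyn]
  have hc := h.closing
  simp only [snx, snxb, show n ≠ n - 1 by omega, if_true, if_false]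
  refine mul_left_cancel₀ hxn ?_
  rw [← sub_eq_zero, ← hc]
  field_simp
  ring

theorem Uf_mid (hn : 2 ≤ n) (h : VRec n x xb y yb v w) (i : ℕ) (h2 : 2 ≤ i) (hi : i ≤ n - 2)
    (hs : 1 / x i + 1 / yb i ≠ 0) :
    Uf n x xb y yb i = v i * w i + (lev n x xb - lev n y yb) * (v i - w i) := by
  rw [Uf, if_neg (by omega), if_neg (by omega), h.Vf_eq hn i hi, h.Vst_eq hn i hi,
    h.Vf_eq hn _ (by omega), h.Vst_eq hn _ (by omega), inv_mul_eq_iff_eq_mul₀ hs]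
  obtain ⟨j, rfl⟩ : ∃ j, i = j + 1 := ⟨i - 1, by omega⟩
  have hv := h.v_succ j hi
  have hw := h.w_succ j hi
  have hx := h.x_ne (j + 1) (by omega) (by omega)
  have hyb := h.yb_ne (j + 1) (by omega) (by omega)
  rw [mul_comm, ← div_eq_iff hyb] at hv
  rw [mul_comm, ← div_eq_iff hx] at hw
  rw [Nat.add_sub_cancel]
  linear_combination - v (j + 1) * hw - w (j + 1) * hv

end VRec

/-- The array `τ` with its two entries at the fork `{0, 1}` merged into position `1`. -/
def forkMul {F : Type*} [Field F] (τ : ℕ → F) : ℕ → F :=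
  fun i => if i = 1 then τ 0 * τ 1 else τ i

/-- The tau-function expression of `V_i` for `0 ≤ i ≤ n-2`. -/
def tauV {F : Type*} [Field F] (γ : F) (t1 t2 t3 t4 S N : ℕ → F) : ℕ → F :=
  fun i => if i = 0 then γ * t2 0 * t4 0 / (t1 0 * t3 0)
    else γ * S i * forkMul t2 i / (N i * forkMul t3 i)

theorem forkMul_ne_zero {F : Type*} [Field F] {n : ℕ} {τ : ℕ → F} (hτ : ∀ i ≤ n, τ i ≠ 0)
    (i : ℕ) (hi : i ≤ n) : forkMul τ i ≠ 0 := by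
  unfold forkMul
  split_ifs with h
  · exact mul_ne_zero (hτ 0 (by omega)) (hτ 1 (by omega))
  · exact hτ i hi

section brackets

variable {F : Type*} [Field F] {n : ℕ} (μ μb τ C τ' : ℕ → F)

theorem brkX_one : brkX n μ τ C τ' 1 = (μ 1)⁻¹ * (τ 0 * τ' 1 / C 1) := by
  simp [brkX]

theorem brkXb_one : brkXb n μb τ C τ' 1 = (μb 1)⁻¹ * (τ 1 * τ' 0 / C 1) := by
  simp [brkXb]

theorem brkX_mid (j : ℕ) (h1 : 1 ≤ j) (hj : j + 1 ≤ n - 2) :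
    brkX n μ τ C τ' (j + 1)
      = (μ (j + 1))⁻¹ * (C j * τ' (j + 1) / (C (j + 1) * forkMul τ' j)) := by
  rcases h1.eq_or_lt with rfl | h
  · simp [brkX, forkMul, mul_assoc]
  · simp [brkX, forkMul, show j ≠ 0 by omega, show j ≠ 1 by omega, show j + 1 ≠ n - 1 by omega,
      show j + 1 ≠ n by omega]

theorem brkXb_mid (j : ℕ) (h1 : 1 ≤ j) (hj : j + 1 ≤ n - 2) :
    brkXb n μb τ C τ' (j + 1)
      = (μb (j + 1))⁻¹ * (C j * τ (j + 1) / (C (j + 1) * forkMul τ j)) := by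
  rcases h1.eq_or_lt with rfl | h
  · simp [brkXb, forkMul, mul_assoc]
  · simp [brkXb, forkMul, show j ≠ 0 by omega, show j ≠ 1 by omega,
      show j + 1 ≠ n - 1 by omega]

theorem brkX_pred (hn : 4 ≤ n) : brkX n μ τ C τ' (n - 1)
    = (μ (n - 1))⁻¹ * (C (n - 2) * τ' (n - 1) / (τ (n - 1) * forkMul τ' (n - 2))) := by
  simp [brkX, forkMul, show n - 1 ≠ 1 by omega, show n - 1 ≠ 2 by omega,
    show n - 2 ≠ 1 by omega]

theorem brkXb_pred (hn : 4 ≤ n) : brkXb n μb τ C τ' (n - 1)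
    = (μb (n - 1))⁻¹ * (C (n - 2) * τ n / (forkMul τ (n - 2) * τ' n)) := by
  simp [brkXb, forkMul, show n - 1 ≠ 1 by omega, show n - 1 ≠ 2 by omega,
    show n - 2 ≠ 1 by omega]

theorem brkX_last (hn : 4 ≤ n) : brkX n μ τ C τ' n
    = (μ n)⁻¹ * (τ (n - 1) * τ' n / (τ n * τ' (n - 1))) := by
  simp [brkX, show n ≠ 1 by omega, show n ≠ 2 by omega, show n ≠ n - 1 by omega]

variable {μ μb τ C τ'}

theorem brkX_ne_zero (hn : 4 ≤ n) (hμ : ∀ i, 1 ≤ i → i ≤ n → μ i ≠ 0) (hτ : ∀ i ≤ n, τ i ≠ 0)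
    (hC : ∀ i, 1 ≤ i → i ≤ n - 2 → C i ≠ 0) (hτ' : ∀ i ≤ n, τ' i ≠ 0)
    (i : ℕ) (h1 : 1 ≤ i) (hi : i ≤ n) : brkX n μ τ C τ' i ≠ 0 := by
  rcases (show i = 1 ∨ i = n ∨ i = n - 1 ∨ (2 ≤ i ∧ i ≤ n - 2) by omega)
    with rfl | rfl | rfl | ⟨h2, h3⟩
  · rw [brkX_one]
    exact mul_ne_zero (inv_ne_zero (hμ _ h1 hi)) (div_ne_zero
      (mul_ne_zero (hτ _ (by omega)) (hτ' _ (by omega))) (hC _ (by omega) (by omega)))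
  · rw [brkX_last _ _ _ _ hn]
    exact mul_ne_zero (inv_ne_zero (hμ _ h1 hi)) (div_ne_zero
      (mul_ne_zero (hτ _ (by omega)) (hτ' _ (by omega)))
      (mul_ne_zero (hτ _ (by omega)) (hτ' _ (by omega))))
  · rw [brkX_pred _ _ _ _ hn]
    exact mul_ne_zero (inv_ne_zero (hμ _ h1 hi)) (div_ne_zero
      (mul_ne_zero (hC _ (by omega) (by omega)) (hτ' _ (by omega)))
      (mul_ne_zero (hτ _ (by omega)) (forkMul_ne_zero hτ' _ (by omega))))
  · obtain ⟨j, rfl⟩ : ∃ j, i = j + 1 := ⟨i - 1, by omega⟩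
    rw [brkX_mid _ _ _ _ j (by omega) h3]
    exact mul_ne_zero (inv_ne_zero (hμ _ h1 hi)) (div_ne_zero
      (mul_ne_zero (hC _ (by omega) (by omega)) (hτ' _ (by omega)))
      (mul_ne_zero (hC _ (by omega) (by omega)) (forkMul_ne_zero hτ' _ (by omega))))

theorem brkXb_ne_zero (hn : 4 ≤ n) (hμb : ∀ i, 1 ≤ i → i ≤ n - 1 → μb i ≠ 0) (hτ : ∀ i ≤ n, τ i ≠ 0)
    (hC : ∀ i, 1 ≤ i → i ≤ n - 2 → C i ≠ 0) (hτ' : ∀ i ≤ n, τ' i ≠ 0)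
    (i : ℕ) (h1 : 1 ≤ i) (hi : i ≤ n - 1) : brkXb n μb τ C τ' i ≠ 0 := by
  rcases (show i = 1 ∨ i = n - 1 ∨ (2 ≤ i ∧ i ≤ n - 2) by omega) with rfl | rfl | ⟨h2, h3⟩
  · rw [brkXb_one]
    exact mul_ne_zero (inv_ne_zero (hμb _ h1 hi)) (div_ne_zero
      (mul_ne_zero (hτ _ (by omega)) (hτ' _ (by omega))) (hC _ (by omega) (by omega)))
  · rw [brkXb_pred _ _ _ _ hn]
    exact mul_ne_zero (inv_ne_zero (hμb _ h1 hi)) (div_ne_zero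
      (mul_ne_zero (hC _ (by omega) (by omega)) (hτ _ (by omega)))
      (mul_ne_zero (forkMul_ne_zero hτ _ (by omega)) (hτ' _ (by omega))))
  · obtain ⟨j, rfl⟩ : ∃ j, i = j + 1 := ⟨i - 1, by omega⟩
    rw [brkXb_mid _ _ _ _ j (by omega) h3]
    exact mul_ne_zero (inv_ne_zero (hμb _ h1 hi)) (div_ne_zero
      (mul_ne_zero (hC _ (by omega) (by omega)) (hτ _ (by omega)))
      (mul_ne_zero (hC _ (by omega) (by omega)) (forkMul_ne_zero hτ _ (by omega))))

theorem lev_brk (hn : 4 ≤ n) (hτ : ∀ i ≤ n, τ i ≠ 0)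
    (hC : ∀ i, 1 ≤ i → i ≤ n - 2 → C i ≠ 0) (hτ' : ∀ i ≤ n, τ' i ≠ 0) :
    lev n (brkX n μ τ C τ') (brkXb n μb τ C τ') = (lev n μ μb)⁻¹ := by
  have prod_brk : ∀ j, j + 1 ≤ n - 2 →
      (∏ i ∈ Finset.Icc 1 (j + 1), brkX n μ τ C τ' i)
          * ∏ i ∈ Finset.Icc 1 (j + 1), brkXb n μb τ C τ' i
        = ((∏ i ∈ Finset.Icc 1 (j + 1), μ i) * ∏ i ∈ Finset.Icc 1 (j + 1), μb i)⁻¹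
          * (forkMul τ (j + 1) * forkMul τ' (j + 1) / C (j + 1) ^ 2) := by
    intro j
    induction j with
    | zero =>
      intro _
      simp only [zero_add, Finset.Icc_self, Finset.prod_singleton, brkX_one, brkXb_one, forkMul,
        if_true, mul_inv]
      ring
    | succ j ih =>
      intro hj
      have ih := ih (by omega)
      simp only [Finset.prod_Icc_succ_top (show 1 ≤ j + 1 + 1 by omega)]
      rw [mul_mul_mul_comm, ih, brkX_mid _ _ _ _ _ (by omega) hj,
        brkXb_mid _ _ _ _ _ (by omega) hj]
      have h1 := hC (j + 1) (by omega) (by omega)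
      have h2 := forkMul_ne_zero hτ (j + 1) (by omega)
      have h3 := forkMul_ne_zero hτ' (j + 1) (by omega)
      rw [show forkMul τ (j + 1 + 1) = τ (j + 1 + 1) by simp [forkMul],
        show forkMul τ' (j + 1 + 1) = τ' (j + 1 + 1) by simp [forkMul]]
      generalize (∏ i ∈ Finset.Icc 1 (j + 1), μ i) = A
      generalize (∏ i ∈ Finset.Icc 1 (j + 1), μb i) = B
      simp only [mul_inv]
      field_simp
  have hX := brkX_pred μ τ C τ' hn
  have hXb := brkXb_pred μb τ C τ' hn
  have hXn := brkX_last μ τ C τ' hn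
  obtain ⟨p, rfl⟩ : ∃ p, n = p + 3 := ⟨n - 3, by omega⟩
  have h := prod_brk p (by simp)
  simp only [show p + 3 - 1 = p + 2 from rfl, show p + 3 - 2 = p + 1 from rfl] at *
  simp only [lev, show p + 3 - 1 = p + 2 from rfl,
    Finset.prod_Icc_succ_top (show 1 ≤ p + 3 by omega),
    Finset.prod_Icc_succ_top (show 1 ≤ p + 2 by omega)]
  rw [show ∀ a b c d e : F, a * b * c * (d * e) = (a * d) * (b * c * e) by intros; ring, h,
    hX, hXb, hXn]
  have h1 := hC (p + 1) (by omega) (by omega)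
  have h2 := forkMul_ne_zero hτ (p + 1) (by omega)
  have h3 := forkMul_ne_zero hτ' (p + 1) (by omega)
  have h4 := hτ (p + 2) (by omega)
  have h5 := hτ' (p + 2) (by omega)
  have h6 := hτ (p + 3) (by omega)
  have h7 := hτ' (p + 3) (by omega)
  generalize (∏ i ∈ Finset.Icc 1 (p + 1), μ i) = A
  generalize (∏ i ∈ Finset.Icc 1 (p + 1), μb i) = B
  simp only [mul_inv]
  field_simp

end brackets

section nodes

variable {F : Type*} [Field F] {γ δ α β : F}

theorem tau_step_first {κb lam lamb N W S t0 b₀ b₁ c₀ c₁ d₀ t : F}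
    (hκ : κb ≠ 0) (hN : N ≠ 0) (hb₀ : b₀ ≠ 0) (hb₁ : b₁ ≠ 0) (hc₀ : c₀ ≠ 0)
    (hc₁ : c₁ ≠ 0) (ht : t ≠ 0)
    (h2 : κb * N * c₀ + lam * W * t = β * t0 * b₁)
    (h3 : κb * S * b₀ - lamb * W * d₀ = α * t0 * c₁) (hγ : γ * α = δ * β) :
    γ * S * (b₀ * b₁) / (N * (c₀ * c₁)) = κb⁻¹ * (b₁ * t / N) *
      (γ * b₀ * d₀ / (t * c₀) / (lamb⁻¹ * (c₁ * b₀ / W))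
        + δ * (1 / (lam⁻¹ * (c₀ * b₁ / W)) + 1 / (κb⁻¹ * (b₁ * t / N)))) := by
  have e : ∀ z, z / (lamb⁻¹ * (c₁ * b₀ / W)) = z * lamb * (W / (c₁ * b₀)) := by
    intro z; simp [div_eq_mul_inv]; ring
  have e' : 1 / (lam⁻¹ * (c₀ * b₁ / W)) = lam * (W / (c₀ * b₁)) := by
    simp [div_eq_mul_inv]; ring
  rw [e, e']
  field_simp
  linear_combination b₁ * γ * h3 - δ * c₁ * h2 + b₁ * t0 * c₁ * hγ

theorem tau_step_mid {κb lam lamb N' N W' W S' S t0 a b c d : F}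
    (hκ : κb ≠ 0) (hN' : N' ≠ 0) (hN : N ≠ 0) (hW' : W' ≠ 0) (ha : a ≠ 0)
    (hb : b ≠ 0) (hc : c ≠ 0) (hd : d ≠ 0)
    (h2 : κb * W' * N + lam * N' * W = β * t0 * a)
    (h3 : κb * W' * S - lamb * S' * W = α * t0 * c) (hγ : γ * α = δ * β) :
    γ * S * a / (N * c) = κb⁻¹ * (N' * a / (N * b)) *
      (γ * S' * b / (N' * d) / (lamb⁻¹ * (W' * c / (W * d)))
        + δ * (1 / (lam⁻¹ * (W' * a / (W * b))) + 1 / (κb⁻¹ * (N' * a / (N * b))))) := by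
  have e : ∀ z, z / (lamb⁻¹ * (W' * c / (W * d))) = z * lamb * (W * d / (W' * c)) := by
    intro z; simp [div_eq_mul_inv]; ring
  have e' : 1 / (lam⁻¹ * (W' * a / (W * b))) = lam * (W * b / (W' * a)) := by
    simp [div_eq_mul_inv]; ring
  rw [e, e']
  field_simp
  linear_combination γ * h3 * a - δ * c * h2 + a * t0 * c * hγ

theorem tau_step_last {κb κn lam lamb N' W' S' t0 a₁ a b c₁ c d t₁ t f : F}
    (hκ : κb ≠ 0) (hκn : κn ≠ 0) (hN' : N' ≠ 0) (hW' : W' ≠ 0) (ha₁ : a₁ ≠ 0) (ha : a ≠ 0)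
    (hb : b ≠ 0) (hc : c ≠ 0) (hd : d ≠ 0) (ht₁ : t₁ ≠ 0) (ht : t ≠ 0)
    (h2 : κn * κb * W' * t₁ + lam * N' * c₁ = β * t0 * a₁)
    (h3 : κb * W' * f - lamb * S' * a = α * t0 * c) (hγ : γ * α = δ * β) :
    κb⁻¹ * (N' * a / (b * t)) / (κn⁻¹ * (a₁ * t / (a * t₁))) *
      (κn⁻¹ * (a₁ * t / (a * t₁)) * (γ * S' * b / (N' * d)) / (lamb⁻¹ * (W' * c / (d * a)))
        + δ * (κn⁻¹ * (a₁ * t / (a * t₁)) / (lam⁻¹ * (W' * a₁ / (c₁ * b)))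
          + 1 / (κb⁻¹ * (N' * a / (b * t))))) = γ * a * f / (t * c) := by
  have e : ∀ z, z / (lamb⁻¹ * (W' * c / (d * a))) = z * lamb * (d * a / (W' * c)) := by
    intro z; simp [div_eq_mul_inv]; ring
  have e' : ∀ z, z / (lam⁻¹ * (W' * a₁ / (c₁ * b))) = z * lam * (c₁ * b / (W' * a₁)) := by
    intro z; simp [div_eq_mul_inv]; ring
  rw [e, e']
  field_simp
  linear_combination -γ * h3 * a₁ + δ * c * h2 - a₁ * t0 * c * hγ

theorem tau_closing {κ κb κn lam lamb lamn N' W' S' E' t0 a₁ a c₁ c t₁ t f₁ f : F}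
    (hα : α ≠ 0) (ht0 : t0 ≠ 0) (hκn : κn ≠ 0) (hlamn : lamn ≠ 0) (ha₁ : a₁ ≠ 0) (ha : a ≠ 0)
    (hc₁ : c₁ ≠ 0) (hc : c ≠ 0) (ht₁ : t₁ ≠ 0) (ht : t ≠ 0)
    (h1 : κ * κn * E' * a - lam * lamn * N' * f = α * t0 * t)
    (h2 : κn * κb * W' * t₁ + lam * N' * c₁ = β * t0 * a₁)
    (h3 : κb * W' * f - lamb * S' * a = α * t0 * c)
    (h4 : κ * E' * c₁ + lamn * lamb * S' * t₁ = β * t0 * f₁) (hγ : γ * α = δ * β) :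
    κn⁻¹ * (a₁ * t / (a * t₁)) * (γ * a * f / (t * c))
      - lamn⁻¹ * (c₁ * a / (c * a₁)) * (γ * a₁ * f₁ / (t₁ * c₁))
      + δ * (lamn⁻¹ * (c₁ * a / (c * a₁)) * (κn⁻¹ * (a₁ * t / (a * t₁))) - 1) = 0 := by
  field_simp
  refine mul_left_cancel₀ (mul_ne_zero ht0 hα) ?_
  linear_combination t0 * (lamn * a₁ * f - κn * a * f₁) * hγ
    + δ * (-lamn * f * h2 + κn * a * h4 + lamn * κn * t₁ * h3 - c₁ * h1)

theorem tau_U_mid {κ κb lam lamb N' N W' W S' S E' E t0 a c t f : F}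
    (hα : α ≠ 0) (ht0 : t0 ≠ 0) (hN : N ≠ 0) (hW : W ≠ 0) (hc : c ≠ 0) (ht : t ≠ 0)
    (h1 : κ * E' * N - lam * N' * E = α * t0 * t)
    (h2 : κb * W' * N + lam * N' * W = β * t0 * a)
    (h3 : κb * W' * S - lamb * S' * W = α * t0 * c)
    (h4 : κ * E' * S + lamb * S' * E = β * t0 * f) (hγ : γ * α = δ * β) :
    γ * S * a / (N * c) * (γ * E * a / (W * t))
      + δ * (γ * S * a / (N * c) - γ * E * a / (W * t)) = γ ^ 2 * a * f / (t * c) := by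
  have key : γ * S * E * a + δ * (S * W * t - E * N * c) = γ * f * N * W := by
    refine mul_left_cancel₀ (mul_ne_zero ht0 hα) ?_
    linear_combination t0 * (S * E * a - f * N * W) * hγ
      + δ * (-S * E * h2 + N * W * h4 - S * W * h1 + E * N * h3)
  field_simp
  linear_combination γ * a * key

theorem tau_inv_add_inv_ne_zero {κb lam N' N W' W t0 a b : F} (hβ : β ≠ 0) (ht0 : t0 ≠ 0)
    (hN' : N' ≠ 0) (hW' : W' ≠ 0)
    (ha : a ≠ 0) (hb : b ≠ 0) (h2 : κb * W' * N + lam * N' * W = β * t0 * a) :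
    1 / (lam⁻¹ * (W' * a / (W * b))) + 1 / (κb⁻¹ * (N' * a / (N * b))) ≠ 0 := by
  have hs : 1 / (lam⁻¹ * (W' * a / (W * b))) + 1 / (κb⁻¹ * (N' * a / (N * b)))
      = β * t0 * b / (W' * N') := by
    field_simp
    linear_combination h2
  rw [hs]
  exact div_ne_zero (mul_ne_zero (mul_ne_zero hβ ht0) hb) (mul_ne_zero hW' hN')

end nodes

set_option maxHeartbeats 1600000 in
theorem stmt11 {F : Type*} [Field F] (n : ℕ) (hn : 4 ≤ n)
    (lam lamb kap kapb : ℕ → F) (α β : F)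
    (hlam : ∀ i, 1 ≤ i → i ≤ n → lam i ≠ 0)
    (hlamb : ∀ i, 1 ≤ i → i ≤ n - 1 → lamb i ≠ 0)
    (hkap : ∀ i, 1 ≤ i → i ≤ n → kap i ≠ 0)
    (hkapb : ∀ i, 1 ≤ i → i ≤ n - 1 → kapb i ≠ 0)
    (l k : F)
    (hl : l = (∏ i ∈ Finset.Icc 1 n, lam i) * ∏ i ∈ Finset.Icc 1 (n - 1), lamb i)
    (hk : k = (∏ i ∈ Finset.Icc 1 n, kap i) * ∏ i ∈ Finset.Icc 1 (n - 1), kapb i)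
    (hlk : l * k * (l - k) ≠ 0)
    (hα : α ≠ 0) (hβ : β ≠ 0)
    (S W N E t0 t1 t2 t3 t4 : ℕ → F)
    (hS : ∀ i, 1 ≤ i → i ≤ n - 2 → S i ≠ 0)
    (hW : ∀ i, 1 ≤ i → i ≤ n - 2 → W i ≠ 0)
    (hN : ∀ i, 1 ≤ i → i ≤ n - 2 → N i ≠ 0)
    (hE : ∀ i, 1 ≤ i → i ≤ n - 2 → E i ≠ 0)
    (ht0 : ∀ i ≤ n, t0 i ≠ 0) (ht1 : ∀ i ≤ n, t1 i ≠ 0) (ht2 : ∀ i ≤ n, t2 i ≠ 0)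
    (ht3 : ∀ i ≤ n, t3 i ≠ 0) (ht4 : ∀ i ≤ n, t4 i ≠ 0)
    (heqs : ∀ J i, 1 ≤ J → J ≤ 4 → i ≤ n →
      BE n lam lamb kap kapb S W N E t0 t1 t2 t3 t4 α β J i)
    (x xb y yb : ℕ → F)
    (hx : x = brkX n lam t3 W t2) (hxb : xb = brkXb n lamb t3 W t2)
    (hy : y = brkX n kap t2 N t1) (hyb : yb = brkXb n kapb t2 N t1)
    (γ : F) (hγ : γ = (k - l) * β / (l * k * α)) :
    Vf n x xb y yb 0 = γ * t2 0 * t4 0 / (t1 0 * t3 0) ∧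
    Vst n x xb y yb 0 = γ * t2 0 * t4 0 / (t1 0 * t3 0) ∧
    Vs1 n x xb y yb 0 = γ * t2 1 * t4 1 / (t1 1 * t3 1) ∧
    Uf n x xb y yb 1 = γ ^ 2 * t2 0 * t2 1 * t4 0 * t4 1 / (t1 0 * t1 1 * t3 0 * t3 1) ∧
    Vf n x xb y yb 1 = γ * S 1 * t2 0 * t2 1 / (N 1 * t3 0 * t3 1) ∧
    Vs1 n x xb y yb 1 = γ * S 1 * t2 0 * t2 1 / (N 1 * t3 0 * t3 1) ∧
    Vst n x xb y yb 1 = γ * E 1 * t2 0 * t2 1 / (W 1 * t1 0 * t1 1) ∧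
    (∀ i, 2 ≤ i → i ≤ n - 2 →
      Vf n x xb y yb i = γ * S i * t2 i / (N i * t3 i) ∧
      Vs1 n x xb y yb i = γ * S i * t2 i / (N i * t3 i) ∧
      Vst n x xb y yb i = γ * E i * t2 i / (W i * t1 i) ∧
      Uf n x xb y yb i = γ ^ 2 * t2 i * t4 i / (t1 i * t3 i)) ∧
    Vf n x xb y yb (n - 1) = γ * t2 n * t4 n / (t1 n * t3 n) ∧
    Vs1 n x xb y yb (n - 1) = γ * t2 n * t4 n / (t1 n * t3 n) ∧
    Vst n x xb y yb (n - 1) = γ * t2 (n - 1) * t4 (n - 1) / (t1 (n - 1) * t3 (n - 1)) ∧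
    Vsn n x xb y yb (n - 1) = γ * t2 (n - 1) * t4 (n - 1) / (t1 (n - 1) * t3 (n - 1)) ∧
    Uf n x xb y yb (n - 1)
      = γ ^ 2 * t2 (n - 1) * t2 n * t4 (n - 1) * t4 n
        / (t1 (n - 1) * t1 n * t3 (n - 1) * t3 n) := by
  simp only [BE] at heqs
  have h10 := heqs 1 0 (by omega) (by omega) (by omega)
  have h11 := heqs 1 1 (by omega) (by omega) (by omega)
  have h1n := heqs 1 n (by omega) (by omega) (by omega)
  have h1p := heqs 1 (n - 1) (by omega) (by omega) (by omega)
  have h20 := heqs 2 0 (by omega) (by omega) (by omega)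
  have h21 := heqs 2 1 (by omega) (by omega) (by omega)
  have h2n := heqs 2 n (by omega) (by omega) (by omega)
  have h2p := heqs 2 (n - 1) (by omega) (by omega) (by omega)
  have h30 := heqs 3 0 (by omega) (by omega) (by omega)
  have h31 := heqs 3 1 (by omega) (by omega) (by omega)
  have h3p := heqs 3 (n - 1) (by omega) (by omega) (by omega)
  have h4p := heqs 4 (n - 1) (by omega) (by omega) (by omega)
  have h1m : ∀ j, 1 ≤ j → j + 1 ≤ n - 2 → kap (j + 1) * E j * N (j + 1)
      - lam (j + 1) * N j * E (j + 1) = α * t0 (j + 1) * t1 (j + 1) := fun j hj hj' => by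
    simpa [show j ≠ 0 by omega, show j + 1 ≠ n - 1 by omega, show j + 1 ≠ n by omega]
      using heqs 1 (j + 1) (by omega) (by omega) (by omega)
  have h2m : ∀ j, 1 ≤ j → j + 1 ≤ n - 2 → kapb (j + 1) * W j * N (j + 1)
      + lam (j + 1) * N j * W (j + 1) = β * t0 (j + 1) * t2 (j + 1) := fun j hj hj' => by
    simpa [show j ≠ 0 by omega, show j + 1 ≠ n - 1 by omega, show j + 1 ≠ n by omega]
      using heqs 2 (j + 1) (by omega) (by omega) (by omega)
  have h3m : ∀ j, 1 ≤ j → j + 1 ≤ n - 2 → kapb (j + 1) * W j * S (j + 1)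
      - lamb (j + 1) * S j * W (j + 1) = α * t0 (j + 1) * t3 (j + 1) := fun j hj hj' => by
    simpa [show j ≠ 0 by omega, show j + 1 ≠ n - 1 by omega, show j + 1 ≠ n by omega]
      using heqs 3 (j + 1) (by omega) (by omega) (by omega)
  have h4m : ∀ j, 1 ≤ j → j + 1 ≤ n - 2 → kap (j + 1) * E j * S (j + 1)
      + lamb (j + 1) * S j * E (j + 1) = β * t0 (j + 1) * t4 (j + 1) := fun j hj hj' => by
    simpa [show j ≠ 0 by omega, show j + 1 ≠ n - 1 by omega, show j + 1 ≠ n by omega]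
      using heqs 4 (j + 1) (by omega) (by omega) (by omega)
  simp [show n ≠ 0 by omega, show n ≠ 1 by omega, show n - 1 ≠ 0 by omega,
    show n - 1 ≠ 1 by omega, show n ≠ n - 1 by omega]
    at h10 h11 h1n h1p h20 h21 h2n h2p h30 h31 h3p h4p
  have hLx : lev n x xb = l⁻¹ := by rw [hx, hxb, lev_brk hn ht3 hW ht2, hl, lev]
  have hKy : lev n y yb = k⁻¹ := by rw [hy, hyb, lev_brk hn ht2 hN ht1, hk, lev]
  have hl0 : l ≠ 0 := left_ne_zero_of_mul (left_ne_zero_of_mul hlk)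
  have hk0 : k ≠ 0 := right_ne_zero_of_mul (left_ne_zero_of_mul hlk)
  have hlk0 : l - k ≠ 0 := right_ne_zero_of_mul hlk
  have hδ : lev n x xb - lev n y yb ≠ 0 := by
    rw [hLx, hKy, inv_sub_inv hl0 hk0, ← neg_sub]
    exact div_ne_zero (neg_ne_zero.2 hlk0) (mul_ne_zero hl0 hk0)
  have hγδ : γ * α = (lev n x xb - lev n y yb) * β := by
    rw [hγ, hLx, hKy]
    field_simp
  have hγδ' : γ * -α = (lev n y yb - lev n x xb) * β := by linear_combination -hγδ
  have hx0 := brkX_ne_zero hn hlam ht3 hW ht2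
  have hxb0 := brkXb_ne_zero hn hlamb ht3 hW ht2
  have hy0 := brkX_ne_zero hn hkap ht2 hN ht1
  have hyb0 := brkXb_ne_zero hn hkapb ht2 hN ht1
  rw [← hx] at hx0
  rw [← hxb] at hxb0
  rw [← hy] at hy0
  rw [← hyb] at hyb0
  have f1 := forkMul_ne_zero ht1
  have f2 := forkMul_ne_zero ht2
  have f3 := forkMul_ne_zero ht3
  have ex1 : x 1 = _ := hx ▸ brkX_one lam t3 W t2
  have exb1 : xb 1 = _ := hxb ▸ brkXb_one lamb t3 W t2
  have ey1 : y 1 = _ := hy ▸ brkX_one kap t2 N t1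
  have eyb1 : yb 1 = _ := hyb ▸ brkXb_one kapb t2 N t1
  have exm := fun j h1 h2 => hx ▸ brkX_mid (n := n) lam t3 W t2 j h1 h2
  have exbm := fun j h1 h2 => hxb ▸ brkXb_mid (n := n) lamb t3 W t2 j h1 h2
  have eym := fun j h1 h2 => hy ▸ brkX_mid (n := n) kap t2 N t1 j h1 h2
  have eybm := fun j h1 h2 => hyb ▸ brkXb_mid (n := n) kapb t2 N t1 j h1 h2
  have exp := hx ▸ brkX_pred lam t3 W t2 hn
  have exbp := hxb ▸ brkXb_pred lamb t3 W t2 hn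
  have eyp := hy ▸ brkX_pred kap t2 N t1 hn
  have eybp := hyb ▸ brkXb_pred kapb t2 N t1 hn
  have exn := hx ▸ brkX_last lam t3 W t2 hn
  have eyn := hy ▸ brkX_last kap t2 N t1 hn
  clear hx hxb hy hyb hLx hKy hγ
  have hvmid : ∀ i, 1 ≤ i → tauV γ t1 t2 t3 t4 S N i
      = γ * S i * forkMul t2 i / (N i * forkMul t3 i) := fun i hi => by
    rw [tauV, if_neg (by omega)]
  have hwmid : ∀ i, 1 ≤ i → tauV γ t3 t2 t1 t4 E W i
      = γ * E i * forkMul t2 i / (W i * forkMul t1 i) := fun i hi => by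
    rw [tauV, if_neg (by omega)]
  have hVlast : yb (n - 1) / y n * (y n * tauV γ t1 t2 t3 t4 S N (n - 2) / xb (n - 1)
      + (lev n x xb - lev n y yb) * (y n / x (n - 1) + 1 / yb (n - 1)))
      = γ * t2 n * t4 n / (t1 n * t3 n) := by
    have step := tau_step_last (hkapb (n - 1) (by omega) (by omega)) (hkap n (by omega) le_rfl)
      (hN (n - 2) (by omega) le_rfl) (hW (n - 2) (by omega) le_rfl) (ht2 (n - 1) (by omega))
      (ht2 n le_rfl) (f2 (n - 2) (by omega)) (ht3 n le_rfl)
      (f3 (n - 2) (by omega)) (ht1 (n - 1) (by omega)) (ht1 n le_rfl) h2p h3p hγδ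
    rw [eyn, eybp, exbp, exp, hvmid (n - 2) (by omega)]
    exact step
  have hWlast : x (n - 1) / x n * (x n * tauV γ t3 t2 t1 t4 E W (n - 2) / y (n - 1)
      + (lev n y yb - lev n x xb) * (x n / yb (n - 1) + 1 / x (n - 1)))
      = γ * t2 (n - 1) * t4 (n - 1) / (t1 (n - 1) * t3 (n - 1)) := by
    have step := tau_step_last (hlam (n - 1) (by omega) (by omega)) (hlam n (by omega) le_rfl)
      (hW (n - 2) (by omega) le_rfl) (hN (n - 2) (by omega) le_rfl) (ht2 n le_rfl)
      (ht2 (n - 1) (by omega)) (f2 (n - 2) (by omega)) (ht1 (n - 1) (by omega))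
      (f1 (n - 2) (by omega)) (ht3 n le_rfl) (ht3 (n - 1) (by omega))
      (show lam n * lam (n - 1) * N (n - 2) * t3 n + kapb (n - 1) * W (n - 2) * t1 n
        = β * t0 n * t2 n by linear_combination h2n)
      (show lam (n - 1) * N (n - 2) * t4 (n - 1) - kap (n - 1) * E (n - 2) * t2 (n - 1)
        = -α * t0 n * t1 (n - 1) by linear_combination -h1n) hγδ'
    rw [exn, exp, eyp, eybp, hwmid (n - 2) (by omega)]
    linear_combination step
  have hlast : y n * (γ * t2 n * t4 n / (t1 n * t3 n))
      - x n * (γ * t2 (n - 1) * t4 (n - 1) / (t1 (n - 1) * t3 (n - 1)))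
      + (lev n x xb - lev n y yb) * (x n * y n - 1) = 0 := by
    rw [exn, eyn]
    exact tau_closing hα (ht0 (n - 1) (by omega)) (hkap n (by omega) le_rfl)
      (hlam n (by omega) le_rfl) (ht2 (n - 1) (by omega)) (ht2 n le_rfl) (ht3 (n - 1) (by omega))
      (ht3 n le_rfl) (ht1 (n - 1) (by omega)) (ht1 n le_rfl) h1p h2p h3p h4p hγδ
  have hrec : VRec n x xb y yb (tauV γ t1 t2 t3 t4 S N) (tauV γ t3 t2 t1 t4 E W) := by
    refine ⟨hx0, hxb0, hy0, hyb0, hδ, ?_, ?_, ?_, ?_⟩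
    · simp [tauV, mul_comm]
    · intro i hi
      rcases Nat.eq_zero_or_pos i with rfl | hi'
      · have step := tau_step_first (hkapb 1 le_rfl (by omega)) (hN 1 le_rfl (by omega))
          (ht2 0 (by omega)) (ht2 1 (by omega)) (ht3 0 (by omega)) (ht3 1 (by omega))
          (ht1 0 (by omega)) h21 h31 hγδ
        simp only [tauV, forkMul, zero_add, one_ne_zero, if_true, if_false, ex1, exb1, eyb1]
        exact step
      · rw [hvmid _ (by omega), hvmid _ hi', exm i hi' hi, exbm i hi' hi, eybm i hi' hi,
          show forkMul t2 (i + 1) = t2 (i + 1) by simp [forkMul, hi'.ne'],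
          show forkMul t3 (i + 1) = t3 (i + 1) by simp [forkMul, hi'.ne']]
        exact tau_step_mid (hkapb _ (by omega) (by omega)) (hN _ hi' (by omega))
          (hN _ (by omega) hi) (hW _ hi' (by omega)) (ht2 _ (by omega)) (f2 _ (by omega))
          (ht3 _ (by omega)) (f3 _ (by omega)) (h2m i hi' hi) (h3m i hi' hi) hγδ
    · intro i hi
      rcases Nat.eq_zero_or_pos i with rfl | hi'
      · have step := tau_step_first (hlam 1 le_rfl (by omega)) (hW 1 le_rfl (by omega))
          (ht2 0 (by omega)) (ht2 1 (by omega)) (ht1 0 (by omega)) (ht1 1 (by omega))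
          (ht3 0 (by omega))
          (show lam 1 * W 1 * t1 0 + kapb 1 * N 1 * t3 0 = β * t0 1 * t2 1 by
            linear_combination h21)
          (show lam 1 * E 1 * t2 0 - kap 1 * N 1 * t4 0 = -α * t0 1 * t1 1 by
            linear_combination -h11) hγδ'
        simp only [tauV, forkMul, zero_add, one_ne_zero, if_true, if_false, ex1, ey1, eyb1]
        linear_combination step
      · rw [hwmid _ (by omega), hwmid _ hi', exm i hi' hi, eym i hi' hi, eybm i hi' hi,
          show forkMul t2 (i + 1) = t2 (i + 1) by simp [forkMul, hi'.ne'],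
          show forkMul t1 (i + 1) = t1 (i + 1) by simp [forkMul, hi'.ne']]
        exact tau_step_mid (hlam _ (by omega) (by omega)) (hW _ hi' (by omega))
          (hW _ (by omega) hi) (hN _ hi' (by omega)) (ht2 _ (by omega)) (f2 _ (by omega))
          (ht1 _ (by omega)) (f1 _ (by omega))
          (show lam (i + 1) * N i * W (i + 1) + kapb (i + 1) * W i * N (i + 1)
            = β * t0 (i + 1) * t2 (i + 1) by linear_combination h2m i hi' hi)
          (show lam (i + 1) * N i * E (i + 1) - kap (i + 1) * E i * N (i + 1)
            = -α * t0 (i + 1) * t1 (i + 1) by linear_combination -h1m i hi' hi) hγδ'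
    · rw [← hVlast, ← hWlast] at hlast
      have := hx0 n (by omega) le_rfl
      have := hy0 n (by omega) le_rfl
      have := hx0 (n - 1) (by omega) (by omega)
      have := hyb0 (n - 1) (by omega) (by omega)
      rw [← hlast]
      generalize tauV γ t1 t2 t3 t4 S N (n - 2) = a
      generalize tauV γ t3 t2 t1 t4 E W (n - 2) = b
      have := hy0 (n - 1) (by omega) (by omega)
      have := hxb0 (n - 1) (by omega) (by omega)
      field_simp
      ring
  have hrec₁ := hrec.swap_one hn (γ * t2 1 * t4 1 / (t1 1 * t3 1))
    (by
      have step := tau_step_first (hkap 1 le_rfl (by omega)) (hN 1 le_rfl (by omega))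
        (ht2 1 (by omega)) (ht2 0 (by omega)) (ht3 1 (by omega)) (ht3 0 (by omega))
        (ht1 1 (by omega)) h20 h30 hγδ
      simp only [tauV, forkMul, one_ne_zero, if_true, if_false, ex1, exb1, ey1]
      linear_combination step)
    (by
      have step := tau_step_first (hlamb 1 le_rfl (by omega)) (hW 1 le_rfl (by omega))
        (ht2 1 (by omega)) (ht2 0 (by omega)) (ht1 1 (by omega)) (ht1 0 (by omega))
        (ht3 1 (by omega))
        (show lamb 1 * W 1 * t1 1 + kap 1 * N 1 * t3 1 = β * t0 0 * t2 0 by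
          linear_combination h20)
        (show lamb 1 * E 1 * t2 1 - kapb 1 * N 1 * t4 1 = -α * t0 0 * t1 0 by
          linear_combination -h10) hγδ'
      simp only [tauV, forkMul, one_ne_zero, if_true, if_false, exb1, ey1, eyb1]
      linear_combination step)
  have hn2 : 2 ≤ n := by omega
  have rV0 : Vf n x xb y yb 0 = γ * t2 0 * t4 0 / (t1 0 * t3 0) := by
    simpa [tauV] using hrec.Vf_eq hn2 0 (by omega)
  have rVs10 : Vs1 n x xb y yb 0 = γ * t2 1 * t4 1 / (t1 1 * t3 1) := by
    simpa [Vs1] using hrec₁.Vf_eq hn2 0 (by omega)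
  have rVs1 : ∀ i, 1 ≤ i → i ≤ n - 2 → Vs1 n x xb y yb i
      = γ * S i * forkMul t2 i / (N i * forkMul t3 i) := fun i h1 hi => by
    rw [Vs1, hrec₁.Vf_eq hn2 i hi, Function.update_of_ne (by omega), hvmid i h1]
  have rVlast := (hrec.Vf_last hn2).trans hVlast
  have rWlast := (hrec.Vst_last hn2).trans hWlast
  refine ⟨rV0, ?_, rVs10, ?_, ?_, ?_, ?_, ?_, rVlast, ?_, rWlast,
    (hrec.Vsn_last hn2).trans rWlast, ?_⟩
  · rw [hrec.Vst_eq hn2 0 (by omega), ← hrec.zero_eq, tauV, if_pos rfl]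
  · rw [Uf, if_pos rfl, rV0, rVs10, div_mul_div_comm]
    congr 1 <;> ring
  · rw [hrec.Vf_eq hn2 1 (by omega), hvmid 1 le_rfl]
    simp only [forkMul, if_true, mul_assoc]
  · rw [rVs1 1 le_rfl (by omega)]
    simp only [forkMul, if_true, mul_assoc]
  · rw [hrec.Vst_eq hn2 1 (by omega), hwmid 1 le_rfl]
    simp only [forkMul, if_true, mul_assoc]
  · intro i h2 hi
    have hfork : ∀ τ : ℕ → F, forkMul τ i = τ i := fun τ => by
      rw [forkMul, if_neg (by omega)]
    refine ⟨?_, ?_, ?_, ?_⟩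
    · rw [hrec.Vf_eq hn2 i hi, hvmid i (by omega), hfork, hfork]
    · rw [rVs1 i (by omega) hi, hfork, hfork]
    · rw [hrec.Vst_eq hn2 i hi, hwmid i (by omega), hfork, hfork]
    · obtain ⟨j, rfl⟩ : ∃ j, i = j + 1 := ⟨i - 1, by omega⟩
      have hs : 1 / x (j + 1) + 1 / yb (j + 1) ≠ 0 := by
        rw [exm j (by omega) hi, eybm j (by omega) hi]
        exact tau_inv_add_inv_ne_zero hβ (ht0 _ (by omega)) (hN _ (by omega) (by omega))
          (hW _ (by omega) (by omega)) (ht2 _ (by omega)) (f2 _ (by omega)) (h2m j (by omega) hi)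
      rw [hrec.Uf_mid hn2 _ h2 hi hs, hvmid _ (by omega), hwmid _ (by omega), hfork, hfork, hfork]
      exact tau_U_mid hα (ht0 _ (by omega)) (hN _ (by omega) hi) (hW _ (by omega) hi)
        (ht3 _ (by omega)) (ht1 _ (by omega)) (h1m j (by omega) hi) (h2m j (by omega) hi)
        (h3m j (by omega) hi) (h4m j (by omega) hi) hγδ
  · rw [Vs1, hrec₁.Vf_last hn2, lev_sw1 n hn2, lev_sw1 n hn2,
      Function.update_of_ne (by omega), ← hVlast]
    simp only [sw1, show n ≠ 1 by omega, show n - 1 ≠ 1 by omega, if_false]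
  · rw [Uf, if_neg (by omega), if_pos rfl, rVlast, rWlast, div_mul_div_comm]
    congr 1 <;> ring
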